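/- Let p be an odd prime, let j be an integer with 0 ≤ j ≤ p−2, and let t be a positive integer with p ∤ t. Then, as an identity in ℤ_p, Γ_p(⟨−tj/(p−1)⟩) · ω(t)^{−tj} · ∏_{h=1}^{t−1} Γ_p(h/t) = ∏_{h=0}^{t−1} Γ_p(⟨(1+h)/t − j/(p−1)⟩), where ω(t) means ω applied to the reduction of t modulo p (a unit, so ω(t)^{−tj} makes sense), and the rational arguments of Γ_p (which lie in ℚ ∩ ℤ_p since p ∤ t) are regarded as p-adic integers. -/

import Mathlib

/-- The rational `q`, regarded as a `p`-adic integer (when `q ∈ ℚ ∩ ℤ_p`). -/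
noncomputable def toZp (p : ℕ) [Fact p.Prime] (q : ℚ) : ℤ_[p] :=
  if h : ‖(q : ℚ_[p])‖ ≤ 1 then ⟨(q : ℚ_[p]), h⟩ else 0

theorem toZp_eq_of_coe_eq {p : ℕ} [Fact p.Prime] {q : ℚ} {z : ℤ_[p]}
    (h : (z : ℚ_[p]) = (q : ℚ_[p])) : toZp p q = z := by
  have hq : ‖(q : ℚ_[p])‖ ≤ 1 := h ▸ z.2
  exact (dif_pos hq).trans (Subtype.ext h.symm)

theorem PadicInt.isUnit_natCast_iff_not_dvd {p : ℕ} [Fact p.Prime] {n : ℕ} :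
    IsUnit (n : ℤ_[p]) ↔ ¬ p ∣ n := by
  rw [← PadicInt.norm_natCast_lt_one_iff, PadicInt.isUnit_iff, not_lt]
  exact ⟨fun h => h.ge, fun h => le_antisymm (PadicInt.norm_le_one _) h⟩

theorem PadicInt.isClopen_setOf_isUnit (p : ℕ) [Fact p.Prime] :
    IsClopen {x : ℤ_[p] | IsUnit x} := by
  refine ⟨?_, Units.isOpen⟩
  simp only [PadicInt.isUnit_iff]
  exact isClosed_eq continuous_norm continuous_const

theorem Nat.count_not_dvd_succ (p n : ℕ) :
    Nat.count (fun k => ¬ p ∣ k) (n + 1) + n / p = n := by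
  induction n with
  | zero => simp [Nat.count_succ]
  | succ n ih =>
    rw [Nat.count_succ, Nat.succ_div]
    split_ifs <;> omega

/-- The product of a function of period `t` over `t` consecutive integers does not depend on the
starting point. -/
theorem Finset.prod_range_int_add_of_periodic {M : Type*} [CommMonoid M] {g : ℤ → M} {t : ℕ}
    (hg : ∀ m, g (m + t) = g m) (N : ℤ) :
    ∏ h ∈ Finset.range t, g (N + h) = ∏ h ∈ Finset.range t, g h := by
  have step (N : ℤ) : ∏ h ∈ Finset.range t, g (N + 1 + h) = ∏ h ∈ Finset.range t, g (N + h) := by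
    cases t with
    | zero => simp
    | succ s =>
      rw [Finset.prod_range_succ, Finset.prod_range_succ']
      congr 1
      · exact Finset.prod_congr rfl fun h _ => by congr 1; push_cast; ring
      · rw [← hg (N + (0 : ℕ))]
        congr 1; push_cast; ring
  induction N using Int.induction_on with
  | zero => simp
  | succ n ih => rw [step, ih]
  | pred n ih => rw [← ih, ← step]; simp

theorem padicGamma_add_one {p : ℕ} [Fact p.Prime] {Γ : ℤ_[p] → ℤ_[p]} (hΓcont : Continuous Γ)
    (hΓzero : Γ 0 = 1)
    (hΓnat : ∀ m : ℕ, 0 < m →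
      Γ (m : ℤ_[p]) = (-1) ^ m * ∏ k ∈ (Finset.Ico 1 m).filter (fun k => ¬ p ∣ k), (k : ℤ_[p]))
    (x : ℤ_[p]) [Decidable (IsUnit x)] :
    Γ (x + 1) = (if IsUnit x then -x else -1) * Γ x := by
  classical
  have hf : Continuous fun y : ℤ_[p] => if IsUnit y then -y else -1 := by
    refine Continuous.if (fun a ha => ?_) continuous_neg continuous_const
    rw [(PadicInt.isClopen_setOf_isUnit p).frontier_eq] at ha
    exact ha.elim
  have key : (fun y => Γ (y + 1)) =
      fun y => (if IsUnit y then -y else -1) * Γ y := by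
    refine DenseRange.equalizer (PadicInt.denseRange_natCast (p := p)) (by fun_prop)
      (hf.mul hΓcont) (funext fun n => ?_)
    simp only [Function.comp_apply, PadicInt.isUnit_natCast_iff_not_dvd]
    rw [← Nat.cast_succ, hΓnat _ n.succ_pos]
    rcases n.eq_zero_or_pos with rfl | hn
    · simp [hΓzero]
    · rw [hΓnat _ hn, Nat.succ_eq_add_one, Finset.Ico_add_one_right_eq_Icc,
        ← Finset.Ico_insert_right hn, Finset.filter_insert]
      by_cases h : p ∣ n
      · simp [h, pow_succ]
      · rw [if_pos h, if_pos h, Finset.prod_insert (by simp)]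
        ring
  convert congrFun key x

theorem padicGamma_prod_natCast {p : ℕ} [Fact p.Prime] {Γ : ℤ_[p] → ℤ_[p]}
    (hΓcont : Continuous Γ) (hΓzero : Γ 0 = 1)
    (hΓnat : ∀ m : ℕ, 0 < m →
      Γ (m : ℤ_[p]) = (-1) ^ m * ∏ k ∈ (Finset.Ico 1 m).filter (fun k => ¬ p ∣ k), (k : ℤ_[p]))
    {t : ℕ} (ht : 0 < t) {u : ℤ_[p]} (hu : (t : ℤ_[p]) * u = 1) (n : ℕ) :
    (∏ h ∈ Finset.range t, Γ ((n + h) * u)) * (t : ℤ_[p]) ^ Nat.count (fun k => ¬ p ∣ k) n =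
      Γ n * ∏ h ∈ Finset.Ico 1 t, Γ (h * u) := by
  classical
  have hadd := padicGamma_add_one hΓcont hΓzero hΓnat
  induction n with
  | zero =>
    rw [Finset.range_eq_Ico, Finset.prod_eq_prod_Ico_succ_bot ht]
    simp [hΓzero]
  | succ n ih =>
    obtain ⟨s, rfl⟩ : ∃ s, t = s + 1 := ⟨t - 1, by omega⟩
    have hunit : IsUnit u := IsUnit.of_mul_eq_one _ ((mul_comm _ _).trans hu)
    have hlast : (((n + 1 : ℕ) : ℤ_[p]) + (s : ℕ)) * u = n * u + 1 := by
      rw [← hu]; push_cast; ring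
    have hshift : ∏ h ∈ Finset.range s, Γ ((((n + 1 : ℕ) : ℤ_[p]) + (h : ℕ)) * u) =
        ∏ h ∈ Finset.range s, Γ ((n + ((h + 1 : ℕ) : ℤ_[p])) * u) :=
      Finset.prod_congr rfl fun h _ => by congr 1; push_cast; ring
    rw [Finset.prod_range_succ, hlast, hshift, hadd]
    rw [Finset.prod_range_succ', Nat.cast_zero, add_zero] at ih
    have hn : ((n + 1 : ℕ) : ℤ_[p]) = n + 1 := by push_cast; ring
    rw [hn, hadd, mul_assoc _ (Γ n), ← ih, Nat.count_succ]
    have hiff : IsUnit ((n : ℤ_[p]) * u) ↔ ¬ p ∣ n := by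
      rw [IsUnit.mul_iff, PadicInt.isUnit_natCast_iff_not_dvd, and_iff_left hunit]
    simp only [hiff, PadicInt.isUnit_natCast_iff_not_dvd]
    generalize ∏ h ∈ Finset.range s, Γ ((n + ((h + 1 : ℕ) : ℤ_[p])) * u) = A
    generalize ((s + 1 : ℕ) : ℤ_[p]) = T at hu ⊢
    split_ifs with h
    · ring
    · rw [pow_succ]
      linear_combination
        (-A * Γ (n * u) * n * T ^ Nat.count (fun k => ¬ p ∣ k) n) * hu

theorem PadicInt.norm_prime_lt_one {p : ℕ} [Fact p.Prime] : ‖(p : ℤ_[p])‖ < 1 :=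
  PadicInt.norm_natCast_lt_one_iff.2 dvd_rfl

theorem PadicInt.tendsto_pow_prime_pow {p : ℕ} [Fact p.Prime] {x w : ℤ_[p]}
    (hw : w ^ p = w) (hx : (p : ℤ_[p]) ∣ x - w) :
    Filter.Tendsto (fun k : ℕ => x ^ p ^ k) Filter.atTop (nhds w) := by
  have hwk (k : ℕ) : w ^ p ^ k = w := by
    induction k with
    | zero => simp
    | succ k ih => rw [pow_succ, pow_mul, ih, hw]
  rw [tendsto_iff_norm_sub_tendsto_zero]
  refine squeeze_zero (fun _ => norm_nonneg _) (fun k => ?_)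
    (tendsto_pow_atTop_nhds_zero_of_lt_one (norm_nonneg (p : ℤ_[p])) PadicInt.norm_prime_lt_one)
  obtain ⟨c, hc⟩ := dvd_sub_pow_of_dvd_sub hx k
  rw [hwk] at hc
  rw [hc, pow_succ, mul_assoc, norm_mul, norm_pow]
  exact mul_le_of_le_one_right (by positivity) (PadicInt.norm_le_one _)

/-- The multiplication formula for the `p`-adic gamma function at `1 - b / (p - 1)`. -/
theorem padicGamma_prod_one_sub {p : ℕ} [Fact p.Prime] {Γ : ℤ_[p] → ℤ_[p]}
    (hΓcont : Continuous Γ) (hΓzero : Γ 0 = 1)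
    (hΓnat : ∀ m : ℕ, 0 < m →
      Γ (m : ℤ_[p]) = (-1) ^ m * ∏ k ∈ (Finset.Ico 1 m).filter (fun k => ¬ p ∣ k), (k : ℤ_[p]))
    {t : ℕ} (ht : 0 < t) {u w v : ℤ_[p]} (hu : (t : ℤ_[p]) * u = 1) (hw : w ^ p = w)
    (htw : (p : ℤ_[p]) ∣ t - w) (hv : ((p : ℤ_[p]) - 1) * v = 1) {b : ℕ} (hb : b < p) :
    (∏ h ∈ Finset.range t, Γ ((1 - b * v + h) * u)) * w ^ b =
      Γ (1 - b * v) * ∏ h ∈ Finset.Ico 1 t, Γ (h * u) := by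
  have hp : 0 < p := (Fact.out : p.Prime).pos
  let S (k : ℕ) : ℕ := ∑ i ∈ Finset.range (k + 1), p ^ i
  have hcount (k : ℕ) : Nat.count (fun i => ¬ p ∣ i) (b * S k + 1) = b * p ^ k := by
    have h1 := Nat.count_not_dvd_succ p (b * S k)
    have h2 : b * S k / p = b * ∑ i ∈ Finset.range k, p ^ i := by
      have : b * S k = b + p * (b * ∑ i ∈ Finset.range k, p ^ i) := by
        simp only [S, Finset.sum_range_succ', pow_succ, ← Finset.sum_mul]
        ring
      rw [this, Nat.add_mul_div_left _ _ hp, Nat.div_eq_of_lt hb, zero_add]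
    have h3 : b * S k = b * (∑ i ∈ Finset.range k, p ^ i) + b * p ^ k := by
      simp only [S, Finset.sum_range_succ, mul_add]
    omega
  have hS (k : ℕ) : ((b * S k + 1 : ℕ) : ℤ_[p]) = 1 - b * v + b * v * p ^ (k + 1) := by
    have hg := geom_sum_mul (p : ℤ_[p]) (k + 1)
    simp only [S]
    push_cast
    linear_combination (b * v : ℤ_[p]) * hg -
      (b * ∑ i ∈ Finset.range (k + 1), (p : ℤ_[p]) ^ i) * hv
  have hlim : Filter.Tendsto (fun k : ℕ => ((b * S k + 1 : ℕ) : ℤ_[p])) Filter.atTop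
      (nhds (1 - b * v)) := by
    simp only [hS]
    have h0 : Filter.Tendsto (fun k : ℕ => (p : ℤ_[p]) ^ (k + 1)) Filter.atTop (nhds 0) :=
      (tendsto_pow_atTop_nhds_zero_of_norm_lt_one PadicInt.norm_prime_lt_one).comp
        (Filter.tendsto_add_atTop_nat 1)
    simpa using (h0.const_mul (b * v : ℤ_[p])).const_add (1 - b * v : ℤ_[p])
  have hL : Filter.Tendsto (fun k : ℕ =>
      (∏ h ∈ Finset.range t, Γ ((((b * S k + 1 : ℕ) : ℤ_[p]) + h) * u)) *
        ((t : ℤ_[p]) ^ p ^ k) ^ b) Filter.atTop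
      (nhds ((∏ h ∈ Finset.range t, Γ ((1 - b * v + h) * u)) * w ^ b)) := by
    have hc : Continuous fun y : ℤ_[p] => ∏ h ∈ Finset.range t, Γ ((y + h) * u) := by fun_prop
    exact ((hc.tendsto _).comp hlim).mul ((PadicInt.tendsto_pow_prime_pow hw htw).pow b)
  have hR := ((hΓcont.tendsto _).comp hlim).mul_const (∏ h ∈ Finset.Ico 1 t, Γ (h * u))
  refine tendsto_nhds_unique hL (hR.congr fun k => ?_)
  rw [Function.comp_apply, ← padicGamma_prod_natCast hΓcont hΓzero hΓnat ht hu, hcount,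
    ← pow_mul, mul_comm (p ^ k)]

/-- **Lemma (4.1), second identity**: for `0 ≤ j ≤ p-2` and `p ∤ t`,
`Γ_p(⟨-tj/(p-1)⟩) · ω(t)^{-tj} · ∏_{h=1}^{t-1} Γ_p(h/t) = ∏_{h=0}^{t-1} Γ_p(⟨(1+h)/t - j/(p-1)⟩)`
as an identity in `ℤ_p`; `ω(t)^{-tj}` is interpreted via `Ring.inverse`, which is the genuine
inverse since `ω(t)` is a unit. -/
theorem padic_gamma_mult_neg (p : ℕ) [Fact p.Prime] (hodd : Odd p)
    (Γ : ℤ_[p] → ℤ_[p]) (hΓcont : Continuous Γ) (hΓzero : Γ 0 = 1)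
    (hΓnat : ∀ m : ℕ, 0 < m →
      Γ (m : ℤ_[p]) = (-1) ^ m * ∏ k ∈ (Finset.Ico 1 m).filter (fun k => ¬ p ∣ k), (k : ℤ_[p]))
    (ω : ZMod p → ℤ_[p]) (hω0 : ω 0 = 0)
    (hωmul : ∀ x y : ZMod p, ω (x * y) = ω x * ω y)
    (hωunit : ∀ x : ZMod p, x ≠ 0 → IsUnit (ω x))
    (hωcong : ∀ x : ZMod p, (p : ℤ_[p]) ∣ (ω x - (x.val : ℤ_[p])))
    (j : ℕ) (hj : j ≤ p - 2) (t : ℕ) (ht : 0 < t) (hpt : ¬ p ∣ t) :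
    Γ (toZp p (Int.fract (-(t * j : ℚ) / ((p : ℚ) - 1)))) *
        Ring.inverse (ω (t : ZMod p)) ^ (t * j) *
        ∏ h ∈ Finset.Ico 1 t, Γ (toZp p ((h : ℚ) / (t : ℚ))) =
      ∏ h ∈ Finset.range t,
        Γ (toZp p (Int.fract ((1 + h : ℚ) / (t : ℚ) - (j : ℚ) / ((p : ℚ) - 1)))) := by
  have hp : p.Prime := Fact.out
  have hp2 : 2 < p := hp.two_le.lt_of_ne fun h => by
    rw [← h] at hodd
    exact absurd hodd (by decide)
  have hω1 : ω 1 = 1 := by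
    have h := hωmul 1 1
    rw [mul_one] at h
    exact ((hωunit 1 one_ne_zero).mul_eq_left).1 h.symm
  let W : ZMod p →* ℤ_[p] := ⟨⟨ω, hω1⟩, hωmul⟩
  have ht0 : (t : ZMod p) ≠ 0 := fun h => hpt ((ZMod.natCast_eq_zero_iff t p).1 h)
  set w := ω (t : ZMod p) with hw
  have hwunit : IsUnit w := hωunit _ ht0
  have hwpow : w ^ (p - 1) = 1 := by
    have : W ((t : ZMod p) ^ (p - 1)) = W t ^ (p - 1) := map_pow W _ _
    rw [ZMod.pow_card_sub_one_eq_one ht0, map_one] at this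
    exact this.symm
  have hwp : w ^ p = w := by
    rw [← pow_sub_one_mul hp.ne_zero, hwpow, one_mul]
  have htw : (p : ℤ_[p]) ∣ t - w := by
    have h1 := hωcong t
    rw [ZMod.val_natCast] at h1
    have h2 : (p : ℤ_[p]) ∣ (t : ℤ_[p]) - (t % p : ℕ) := by
      refine ⟨(t / p : ℕ), ?_⟩
      rw [sub_eq_iff_eq_add]
      exact_mod_cast (Nat.div_add_mod t p).symm
    simpa using dvd_sub h2 h1
  obtain ⟨u, hu⟩ := (PadicInt.isUnit_natCast_iff_not_dvd.2 hpt).exists_right_inv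
  have hpm : ¬ p ∣ p - 1 := Nat.not_dvd_of_pos_of_lt (by omega) (by omega)
  obtain ⟨v, hv⟩ := (PadicInt.isUnit_natCast_iff_not_dvd.2 hpm).exists_right_inv
  rw [Nat.cast_sub hp.one_le, Nat.cast_one] at hv
  obtain ⟨b, q, hb0, hbp, hbq⟩ : ∃ b q : ℕ, 0 < b ∧ b < p ∧ t * j + (p - 1) = b + (p - 1) * q := by
    have hpos : 0 < p - 1 := by omega
    have hdm := Nat.div_add_mod (t * j) (p - 1)
    have hlt := Nat.mod_lt (t * j) hpos
    rcases Nat.eq_zero_or_pos (t * j % (p - 1)) with h | h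
    · exact ⟨p - 1, t * j / (p - 1), hpos, by omega, by omega⟩
    · refine ⟨t * j % (p - 1), t * j / (p - 1) + 1, h, by omega, ?_⟩
      rw [mul_add, mul_one]
      omega
  have hwb : w ^ b = w ^ (t * j) := by
    have := congrArg (w ^ ·) hbq
    simpa [pow_add, pow_mul, hwpow] using this.symm
  have hp1 : (0 : ℚ) < (p : ℚ) - 1 := by
    have : (2 : ℚ) < p := by exact_mod_cast hp2
    linarith
  have htQ : (0 : ℚ) < t := by exact_mod_cast ht
  have hbqQ : (t * j : ℚ) + ((p : ℚ) - 1) = b + ((p : ℚ) - 1) * q := by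
    have := congrArg (Nat.cast : ℕ → ℚ) hbq
    push_cast [Nat.cast_sub hp.one_le] at this
    exact this
  have hbQ : (0 : ℚ) < b := by exact_mod_cast hb0
  have hbQ' : (b : ℚ) ≤ (p : ℚ) - 1 := by
    have : (b : ℚ) + 1 ≤ p := by exact_mod_cast hbp
    linarith
  have hx0 : 0 ≤ 1 - (b : ℚ) / ((p : ℚ) - 1) := by
    rw [sub_nonneg, div_le_one hp1]
    exact hbQ'
  have hx1 : 1 - (b : ℚ) / ((p : ℚ) - 1) < 1 := by
    have := div_pos hbQ hp1
    linarith
  have hfract : Int.fract (-(t * j : ℚ) / ((p : ℚ) - 1)) = 1 - (b : ℚ) / ((p : ℚ) - 1) := by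
    rw [Int.fract_eq_iff]
    refine ⟨hx0, hx1, -q, ?_⟩
    push_cast
    field_simp
    linear_combination -hbqQ
  have huQ : (u : ℚ_[p]) = (t : ℚ_[p])⁻¹ := by
    refine eq_inv_of_mul_eq_one_right ?_
    exact_mod_cast congrArg (Subtype.val) hu
  have hvQ : (v : ℚ_[p]) = ((p : ℚ_[p]) - 1)⁻¹ := by
    refine eq_inv_of_mul_eq_one_right ?_
    exact_mod_cast congrArg (Subtype.val) hv
  have hX : toZp p (Int.fract (-(t * j : ℚ) / ((p : ℚ) - 1))) = 1 - b * v := by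
    rw [hfract]
    refine toZp_eq_of_coe_eq ?_
    push_cast [hvQ]
    rw [div_eq_mul_inv]
  have hIco : ∏ h ∈ Finset.Ico 1 t, Γ (toZp p ((h : ℚ) / (t : ℚ))) =
      ∏ h ∈ Finset.Ico 1 t, Γ (h * u) := by
    refine Finset.prod_congr rfl fun h _ => congrArg Γ (toZp_eq_of_coe_eq ?_)
    push_cast [huQ]
    rw [div_eq_mul_inv]
  let g (m : ℤ) : ℤ_[p] :=
    Γ (toZp p (Int.fract ((m : ℚ) / (t : ℚ) - (j : ℚ) / ((p : ℚ) - 1))))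
  have hg (m : ℤ) : g (m + t) = g m := by
    have : ((m + t : ℤ) : ℚ) / (t : ℚ) - (j : ℚ) / ((p : ℚ) - 1) =
        (m : ℚ) / (t : ℚ) - (j : ℚ) / ((p : ℚ) - 1) + 1 := by
      push_cast
      field_simp
      ring
    simp only [g, this, Int.fract_add_one]
  have hRHS : ∏ h ∈ Finset.range t,
      Γ (toZp p (Int.fract ((1 + h : ℚ) / (t : ℚ) - (j : ℚ) / ((p : ℚ) - 1)))) =
      ∏ h ∈ Finset.range t, Γ ((1 - b * v + h) * u) := by
    have h1 := Finset.prod_range_int_add_of_periodic hg 1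
    have h2 := Finset.prod_range_int_add_of_periodic hg q
    simp only [g] at h1 h2
    push_cast at h1 h2
    rw [h1, ← h2]
    refine Finset.prod_congr rfl fun h hh => congrArg Γ (toZp_eq_of_coe_eq ?_)
    have hht : (h : ℚ) + 1 ≤ t := by exact_mod_cast Finset.mem_range.1 hh
    have hh0 : (0 : ℚ) ≤ h := Nat.cast_nonneg h
    have hval : ((q : ℚ) + h) / t - (j : ℚ) / ((p : ℚ) - 1) =
        (1 - (b : ℚ) / ((p : ℚ) - 1) + h) / t := by
      field_simp
      linear_combination -hbqQ
    rw [hval, Int.fract_eq_self.2]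
    · push_cast [huQ, hvQ]
      simp only [div_eq_mul_inv]
    · constructor
      · positivity
      · rw [div_lt_one htQ]
        linarith
  rw [hX, hIco, hRHS, mul_right_comm, ← padicGamma_prod_one_sub hΓcont hΓzero hΓnat ht hu hwp htw
    hv hbp, hwb, mul_assoc, ← mul_pow, Ring.mul_inverse_cancel _ hwunit, one_pow, mul_one]
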